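/- Let A ∈ ℝ^{2×2×1} be the tensor with A_{1,1,1} = A_{2,2,1} = 1/2 and A_{1,2,1} = A_{2,1,1} = 0 (the tensor corresponding to the matrix (1/2)·I₂). Then ‖A‖' > 1, where ‖X‖' = inf { (Σ_{r=1}^R (‖u_r^{(1)}‖₂ · ‖u_r^{(2)}‖₂ · ‖u_r^{(3)}‖₂)^{2/3})^{3/2} : R ∈ ℕ, u ∈ U_R(X) }. -/

import Mathlib

open Finset

/-- The vector ℓ_p norm on `ℝ^n`. -/
noncomputable def vecLpNorm (p : ℝ) {n : ℕ} (v : Fin n → ℝ) : ℝ :=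
  (∑ i, |v i| ^ p) ^ (1 / p)

/-- `u = (u1, u2, u3)` is a rank-`R` CP decomposition of the tensor `X`. -/
def IsCPDecomp {N₁ N₂ N₃ R : ℕ} (X : Fin N₁ × Fin N₂ × Fin N₃ → ℝ)
    (u1 : Fin R → Fin N₁ → ℝ) (u2 : Fin R → Fin N₂ → ℝ)
    (u3 : Fin R → Fin N₃ → ℝ) : Prop :=
  ∀ i j k, X (i, j, k) = ∑ r, u1 r i * u2 r j * u3 r k

/-- The (2/3)-"nuclear" quantity `‖X‖'`, infimum over all CP decompositions of `X`
of the ℓ_{2/3} quasi-norm of the spectrum. -/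
noncomputable def tensorNorm23 {N₁ N₂ N₃ : ℕ} (X : Fin N₁ × Fin N₂ × Fin N₃ → ℝ) : ℝ :=
  sInf {y : ℝ | ∃ (R : ℕ) (u1 : Fin R → Fin N₁ → ℝ) (u2 : Fin R → Fin N₂ → ℝ)
    (u3 : Fin R → Fin N₃ → ℝ), IsCPDecomp X u1 u2 u3 ∧
    y = (∑ r, (vecLpNorm 2 (u1 r) * vecLpNorm 2 (u2 r) * vecLpNorm 2 (u3 r))
      ^ ((2 : ℝ) / 3)) ^ ((3 : ℝ) / 2)}

theorem vecLpNorm_two {n : ℕ} (v : Fin n → ℝ) : vecLpNorm 2 v = √(∑ i, v i ^ 2) := by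
  simp [vecLpNorm, Real.sqrt_eq_rpow]

/-- If `½ I₂ = ∑ r, x r (y r)ᵀ` and `a r` is the cube root of `‖x r‖ ‖y r‖`, then
`(∑ r, a r ^ 2) ^ 3 ≥ 2`. -/
theorem two_le_sum_sq_pow_three {ι : Type*} [Fintype ι] (x y : ι → Fin 2 → ℝ) (a : ι → ℝ)
    (ha : ∀ r, 0 ≤ a r)
    (hxy : ∀ r, (a r ^ 3) ^ 2 = (x r 0 ^ 2 + x r 1 ^ 2) * (y r 0 ^ 2 + y r 1 ^ 2))
    (hsum : ∀ i j, ∑ r, x r i * y r j = if i = j then 1 / 2 else 0) :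
    2 ≤ (∑ r, a r ^ 2) ^ 3 := by
  classical
  have h00 : ∑ r, x r 0 * y r 0 = 1 / 2 := by simpa using hsum 0 0
  have h11 : ∑ r, x r 1 * y r 1 = 1 / 2 := by simpa using hsum 1 1
  have h01 : ∑ r, x r 0 * y r 1 = 0 := by simpa using hsum 0 1
  have h10 : ∑ r, x r 1 * y r 0 = 0 := by simpa using hsum 1 0
  set T := ∑ r, a r ^ 2 with hT
  have hT0 : 0 ≤ T := Finset.sum_nonneg fun r _ => sq_nonneg _
  -- the trace is bounded by the nuclear norm
  have htrace : 1 ≤ ∑ r, a r * a r ^ 2 := by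
    have h : ∑ r, (x r 0 * y r 0 + x r 1 * y r 1) = 1 := by
      rw [Finset.sum_add_distrib, h00, h11]; norm_num
    rw [← h]
    refine Finset.sum_le_sum fun r _ => ?_
    have h3 : a r * a r ^ 2 = a r ^ 3 := by ring
    rw [h3]
    refine le_of_abs_le (abs_le_of_sq_le_sq ?_ (pow_nonneg (ha r) 3))
    rw [hxy]
    nlinarith [sq_nonneg (x r 0 * y r 1 - x r 1 * y r 0)]
  have hholder : 1 ≤ T * ∑ r, (a r ^ 2) ^ 2 := by
    have h := Finset.sum_mul_sq_le_sq_mul_sq Finset.univ a fun r => a r ^ 2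
    nlinarith
  -- Cauchy–Binet expansion of the determinant
  have hdet : ∑ r, ∑ s, (x r 0 * x s 1 - x r 1 * x s 0) * (y r 0 * y s 1 - y r 1 * y s 0)
      = 1 / 2 := by
    have h : ∀ r s, (x r 0 * x s 1 - x r 1 * x s 0) * (y r 0 * y s 1 - y r 1 * y s 0)
        = (x r 0 * y r 0) * (x s 1 * y s 1) - (x r 0 * y r 1) * (x s 1 * y s 0)
          - (x r 1 * y r 0) * (x s 0 * y s 1) + (x r 1 * y r 1) * (x s 0 * y s 0) := by
      intro r s; ring
    simp only [h, Finset.sum_add_distrib, Finset.sum_sub_distrib, ← Finset.mul_sum,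
      ← Finset.sum_mul, h00, h01, h10, h11]
    norm_num
  have hterm : ∀ r s, (x r 0 * x s 1 - x r 1 * x s 0) * (y r 0 * y s 1 - y r 1 * y s 0)
      ≤ T / 2 * (a r ^ 2 * a s ^ 2 - if r = s then (a r ^ 2) ^ 2 else 0) := by
    intro r s
    split_ifs with hrs
    · subst hrs
      exact le_of_eq (by ring)
    · have hpair : a r ^ 2 + a s ^ 2 ≤ T := by
        rw [hT, ← Finset.sum_pair (f := fun r => a r ^ 2) hrs]
        exact Finset.sum_le_sum_of_subset_of_nonneg (Finset.subset_univ _)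
          fun _ _ _ => sq_nonneg _
      have hnorm : (x r 0 * x s 1 - x r 1 * x s 0) * (y r 0 * y s 1 - y r 1 * y s 0)
          ≤ a r ^ 3 * a s ^ 3 := by
        refine le_of_abs_le (abs_le_of_sq_le_sq ?_
          (mul_nonneg (pow_nonneg (ha r) 3) (pow_nonneg (ha s) 3)))
        have hx : (x r 0 * x s 1 - x r 1 * x s 0) ^ 2
            ≤ (x r 0 ^ 2 + x r 1 ^ 2) * (x s 0 ^ 2 + x s 1 ^ 2) := by
          nlinarith [sq_nonneg (x r 0 * x s 0 + x r 1 * x s 1)]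
        have hy : (y r 0 * y s 1 - y r 1 * y s 0) ^ 2
            ≤ (y r 0 ^ 2 + y r 1 ^ 2) * (y s 0 ^ 2 + y s 1 ^ 2) := by
          nlinarith [sq_nonneg (y r 0 * y s 0 + y r 1 * y s 1)]
        rw [mul_pow, mul_pow (a r ^ 3), hxy, hxy]
        exact (mul_le_mul hx hy (sq_nonneg _) (by positivity)).trans_eq (by ring)
      have hamgm : a r * a s ≤ T / 2 := by nlinarith [sq_nonneg (a r - a s)]
      calc _ ≤ a r ^ 3 * a s ^ 3 := hnorm
        _ = (a r * a s) * (a r ^ 2 * a s ^ 2) := by ring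
        _ ≤ T / 2 * (a r ^ 2 * a s ^ 2) := by gcongr
        _ = _ := by ring
  have hbound : 1 / 2 ≤ T / 2 * (T ^ 2 - ∑ r, (a r ^ 2) ^ 2) := by
    rw [← hdet]
    refine (Finset.sum_le_sum fun r _ => Finset.sum_le_sum fun s _ => hterm r s).trans_eq ?_
    simp only [← Finset.mul_sum, Finset.sum_sub_distrib, ← Finset.sum_mul, Finset.sum_ite_eq,
      Finset.mem_univ, if_true, ← hT]
    ring
  nlinarith

theorem stmt_7 (A : Fin 2 × Fin 2 × Fin 1 → ℝ)
    (hA : ∀ i j k, A (i, j, k) = if i = j then 1 / 2 else 0) :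
    1 < tensorNorm23 A := by
  refine lt_of_lt_of_le (b := √2) (Real.lt_sqrt_of_sq_lt (by norm_num)) (le_csInf ?_ ?_)
  · refine ⟨_, 2, fun r i => if r = i then 1 / 2 else 0, fun r j => if r = j then 1 else 0,
      fun _ _ => 1, fun i j k => ?_, rfl⟩
    rw [hA]
    fin_cases i <;> fin_cases j <;> simp
  · rintro _ ⟨R, u1, u2, u3, hu, rfl⟩
    set s : Fin R → ℝ := fun r => vecLpNorm 2 (u1 r) * vecLpNorm 2 (u2 r) * vecLpNorm 2 (u3 r)
      with hs
    have hs0 : ∀ r, 0 ≤ s r := fun r => by simp only [hs, vecLpNorm_two]; positivity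
    have hcube : ∀ r, (s r ^ ((1 : ℝ) / 3)) ^ 3 = s r := fun r => by
      rw [← Real.rpow_natCast, ← Real.rpow_mul (hs0 r)]; norm_num
    have hsq : ∀ r, s r ^ ((2 : ℝ) / 3) = (s r ^ ((1 : ℝ) / 3)) ^ 2 := fun r => by
      rw [← Real.rpow_natCast, ← Real.rpow_mul (hs0 r)]; norm_num
    have key := two_le_sum_sq_pow_three (fun r i => u1 r i * u3 r 0) u2
      (fun r => s r ^ ((1 : ℝ) / 3)) (fun r => Real.rpow_nonneg (hs0 r) _)
      (fun r => by
        simp only [hcube]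
        simp only [hs, vecLpNorm_two, mul_pow]
        rw [Real.sq_sqrt (by positivity), Real.sq_sqrt (by positivity),
          Real.sq_sqrt (by positivity)]
        simp only [Fin.sum_univ_two, Fin.sum_univ_one]
        ring)
      (fun i j => by
        rw [← hA i j 0, hu i j 0]
        exact Finset.sum_congr rfl fun r _ => by ring)
    change √2 ≤ (∑ r, s r ^ ((2 : ℝ) / 3)) ^ ((3 : ℝ) / 2)
    simp only [hsq]
    have hT0 : 0 ≤ ∑ r, (s r ^ ((1 : ℝ) / 3)) ^ 2 := Finset.sum_nonneg fun r _ => sq_nonneg _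
    refine (Real.sqrt_le_sqrt key).trans_eq ?_
    rw [Real.sqrt_eq_rpow, ← Real.rpow_natCast, ← Real.rpow_mul hT0]
    norm_num
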